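/- Fix w > 0 and a_b > 0, let C_0 = (erf(√(π/2) · a_b/w))² and C_2 = -√2 · (a_b/w) · erf(√(π/2) · a_b/w) · exp(-π a_b²/(2 w²)), and define the Gaussian approximation g(r) = C_0 · exp(-(2/w²) · (|C_2|/C_0) · r²) and F(r) = (2/(π w²)) ∫_{-√π a_b/2}^{√π a_b/2} ∫_{-√π a_b/2}^{√π a_b/2} exp(-2((x - r)² + y²)/w²) dx dy. Then g agrees with F to second order at r = 0: g(0) = F(0), g'(0) = F'(0) = 0, and g''(0) = F''(0). -/

import Mathlib

open Real MeasureTheory intervalIntegral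

/-- The error function `erf x = (2/√π) ∫_0^x exp(-t²) dt`. -/
noncomputable def erf (x : ℝ) : ℝ :=
  (2 / Real.sqrt Real.pi) * ∫ t in (0:ℝ)..x, Real.exp (-t ^ 2)

theorem hasDerivAt_erf (x : ℝ) :
    HasDerivAt erf (2 / √π * Real.exp (-x ^ 2)) x := by
  have hc : Continuous fun t : ℝ => Real.exp (-t ^ 2) := by fun_prop
  exact (hc.integral_hasStrictDerivAt 0 x).hasDerivAt.const_mul (2 / √π)

theorem erf_neg (x : ℝ) : erf (-x) = -erf x := by
  have h := integral_comp_neg (a := 0) (b := x) fun t : ℝ => Real.exp (-t ^ 2)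
  simp only [even_two.neg_pow, neg_zero] at h
  rw [erf, erf, integral_symm, ← h, mul_neg]

theorem erf_pos {x : ℝ} (hx : 0 < x) : 0 < erf x := by
  have hc : Continuous fun t : ℝ => Real.exp (-t ^ 2) := by fun_prop
  have h := intervalIntegral_pos_of_pos (hc.intervalIntegrable 0 x)
    (fun t => Real.exp_pos _) hx
  unfold erf
  positivity

theorem integral_exp_neg_sq_eq_erf (a b : ℝ) :
    ∫ t in a..b, Real.exp (-t ^ 2) = √π / 2 * (erf b - erf a) := by
  have hc : Continuous fun t : ℝ => Real.exp (-t ^ 2) := by fun_prop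
  have h := integral_interval_sub_left (μ := volume)
    (hc.intervalIntegrable 0 b) (hc.intervalIntegrable 0 a)
  have hp : 0 < √π := Real.sqrt_pos.2 Real.pi_pos
  rw [← h, erf, erf]
  field_simp

theorem integral_exp_neg_mul_sub_sq (k L d : ℝ) (hk : k ≠ 0) :
    ∫ x in (-L)..L, Real.exp (-(k * x - d) ^ 2) =
      √π / (2 * k) * (erf (k * L + d) + erf (k * L - d)) := by
  rw [integral_comp_mul_sub (fun t => Real.exp (-t ^ 2)) hk, integral_exp_neg_sq_eq_erf,
    show k * -L - d = -(k * L + d) by ring, erf_neg, smul_eq_mul]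
  field_simp
  ring

theorem integral_integral_gaussian_square (w L r : ℝ) (hw : 0 < w) :
    2 / (π * w ^ 2) * (∫ y in (-L)..L, ∫ x in (-L)..L,
        Real.exp (-2 * ((x - r) ^ 2 + y ^ 2) / w ^ 2)) =
      erf (√2 / w * L) / 2 * (erf (√2 / w * L + √2 / w * r) + erf (√2 / w * L - √2 / w * r)) := by
  have hk : √2 / w ≠ 0 := by positivity
  have h2 : √2 ^ 2 = 2 := Real.sq_sqrt zero_le_two
  have hp : √π ^ 2 = π := Real.sq_sqrt Real.pi_pos.le
  have hsplit (x y : ℝ) : Real.exp (-2 * ((x - r) ^ 2 + y ^ 2) / w ^ 2) =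
      Real.exp (-(√2 / w * y - 0) ^ 2) * Real.exp (-(√2 / w * x - √2 / w * r) ^ 2) := by
    rw [← Real.exp_add]
    congr 1
    field_simp
    ring_nf
    rw [h2]
    ring
  simp only [hsplit, intervalIntegral.integral_const_mul, intervalIntegral.integral_mul_const,
    integral_exp_neg_mul_sub_sq _ _ _ hk]
  rw [add_zero, sub_zero]
  field_simp
  rw [h2, hp]
  ring

theorem deriv_const_mul_exp_mul_sq (A c : ℝ) :
    deriv (fun r : ℝ => A * Real.exp (c * r ^ 2)) =
      fun r => A * (Real.exp (c * r ^ 2) * (c * (2 * r))) := by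
  funext r
  have h := (((hasDerivAt_pow 2 r).const_mul c).exp.const_mul A).deriv
  simpa using h

theorem deriv_deriv_const_mul_exp_mul_sq_zero (A c : ℝ) :
    deriv (deriv fun r : ℝ => A * Real.exp (c * r ^ 2)) 0 = 2 * (A * c) := by
  rw [deriv_const_mul_exp_mul_sq]
  have h := ((((hasDerivAt_pow 2 (0 : ℝ)).const_mul c).exp.mul
    (((hasDerivAt_id (0 : ℝ)).const_mul 2).const_mul c)).const_mul A).deriv
  refine h.trans ?_
  simp
  ring

theorem deriv_const_mul_erf_add_erf (B u k : ℝ) :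
    deriv (fun r : ℝ => B * (erf (u + k * r) + erf (u - k * r))) =
      fun r => B * (2 / √π * k * (Real.exp (-(u + k * r) ^ 2) - Real.exp (-(u - k * r) ^ 2))) := by
  funext r
  have hlin : HasDerivAt (fun r : ℝ => k * r) k r := by
    simpa using (hasDerivAt_id r).const_mul k
  have h := ((((hasDerivAt_erf (u + k * r)).comp r (hlin.const_add u)).add
    ((hasDerivAt_erf (u - k * r)).comp r (hlin.const_sub u))).const_mul B).deriv
  refine h.trans ?_
  ring

theorem deriv_deriv_const_mul_erf_add_erf_zero (B u k : ℝ) :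
    deriv (deriv fun r : ℝ => B * (erf (u + k * r) + erf (u - k * r))) 0 =
      -(8 / √π * B * k ^ 2 * u * Real.exp (-u ^ 2)) := by
  rw [deriv_const_mul_erf_add_erf]
  have hlin : HasDerivAt (fun r : ℝ => k * r) k 0 := by
    simpa using (hasDerivAt_id (0 : ℝ)).const_mul k
  have h := (((((hlin.const_add u).pow 2).neg.exp.sub
    ((hlin.const_sub u).pow 2).neg.exp).const_mul (2 / √π * k)).const_mul B).deriv
  refine h.trans ?_
  simp
  ring

theorem stmt_5 (w ab : ℝ) (hw : 0 < w) (hab : 0 < ab)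
    (C0 C2 : ℝ)
    (hC0 : C0 = (erf (Real.sqrt (Real.pi / 2) * ab / w)) ^ 2)
    (hC2 : C2 = -(Real.sqrt 2) * (ab / w) * erf (Real.sqrt (Real.pi / 2) * ab / w) *
      Real.exp (-(Real.pi * ab ^ 2) / (2 * w ^ 2)))
    (g F : ℝ → ℝ)
    (hg : ∀ r : ℝ, g r = C0 * Real.exp (-(2 / w ^ 2) * (|C2| / C0) * r ^ 2))
    (hF : ∀ r : ℝ, F r = (2 / (Real.pi * w ^ 2)) *
      (∫ y in (-(Real.sqrt Real.pi * ab / 2))..(Real.sqrt Real.pi * ab / 2),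
        ∫ x in (-(Real.sqrt Real.pi * ab / 2))..(Real.sqrt Real.pi * ab / 2),
          Real.exp (-2 * ((x - r) ^ 2 + y ^ 2) / w ^ 2))) :
    g 0 = F 0 ∧ deriv g 0 = deriv F 0 ∧ deriv F 0 = 0 ∧
      deriv (deriv g) 0 = deriv (deriv F) 0 := by
  have hsp : 0 < √π := Real.sqrt_pos.2 Real.pi_pos
  have h2 : √2 ^ 2 = 2 := Real.sq_sqrt zero_le_two
  have hp : √π ^ 2 = π := Real.sq_sqrt Real.pi_pos.le
  have hu : √(π / 2) * ab / w = √2 / w * (√π * ab / 2) := by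
    rw [Real.sqrt_div Real.pi_pos.le]
    field_simp
    rw [h2]
  rw [hu] at hC0 hC2
  have hF' : F = fun r => erf (√2 / w * (√π * ab / 2)) / 2 *
      (erf (√2 / w * (√π * ab / 2) + √2 / w * r) +
        erf (√2 / w * (√π * ab / 2) - √2 / w * r)) := by
    funext r
    rw [hF, integral_integral_gaussian_square w _ r hw]
  have hg' : g = fun r => C0 * Real.exp (-(2 / w ^ 2) * (|C2| / C0) * r ^ 2) := funext hg
  have hupos : 0 < √2 / w * (√π * ab / 2) := by positivity
  have husq : (√2 / w * (√π * ab / 2)) ^ 2 = π * ab ^ 2 / (2 * w ^ 2) := by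
    rw [mul_pow, div_pow, div_pow, mul_pow, h2, hp]
    field_simp
  have he := erf_pos hupos
  have hF1 : deriv F 0 = 0 := by
    rw [hF', deriv_const_mul_erf_add_erf]
    simp
  have hg1 : deriv g 0 = 0 := by
    rw [hg', deriv_const_mul_exp_mul_sq]
    simp
  refine ⟨?_, hg1.trans hF1.symm, hF1, ?_⟩
  · rw [hg, hF', hC0]
    simp
    ring
  · have hC0' : C0 ≠ 0 := by
      rw [hC0]
      positivity
    have habs : |C2| = √2 * (ab / w) * erf (√2 / w * (√π * ab / 2)) *
        Real.exp (-(π * ab ^ 2) / (2 * w ^ 2)) := by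
      rw [hC2, neg_mul, neg_mul, neg_mul, abs_neg, abs_of_pos (by positivity)]
    rw [hg', hF', deriv_deriv_const_mul_exp_mul_sq_zero,
      deriv_deriv_const_mul_erf_add_erf_zero, husq,
      show C0 * (-(2 / w ^ 2) * (|C2| / C0)) = -(2 / w ^ 2) * |C2| by field_simp, habs, neg_div,
      div_pow, h2]
    field_simp
    ring
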